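/- Let I be а matching instance of size n with strict preferences, let σ be a permutation of Fin n such that the perfect integral matching μ1 matching man m to woman σ(m) is stable, and suppose the women's envy-graph under μ1 contains a cycle, i.e., there exist distinct women w_1,…,w_k (k ≥ 2) such that w_i envies w_{i+1} for each i (indices taken cyclically). Let μ2 be the perfect integral matching in which each woman w_i in the cycle is matched to the μ1-partner of w_{i+1} (cyclically) and all women outside the cycle keep their μ1-partner. Then there exists x ∈ [0,1) such that for every α ∈ [x,1], the fractional matching α·μ1 + (1−α)·μ2 is stable. -/

import Mathlib

open Finset

/-- Nonnegativity of valuations: part of the definition of a matching instance. -/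
def Nonneg {n : ℕ} (U V : Fin n → Fin n → ℝ) : Prop :=
  ∀ m w, 0 ≤ U m w ∧ 0 ≤ V m w

/-- Strict preferences: each agent's valuations over the other side are injective. -/
def StrictPrefs {n : ℕ} (U V : Fin n → Fin n → ℝ) : Prop :=
  (∀ m, Function.Injective fun w => U m w) ∧ (∀ w, Function.Injective fun m => V m w)

/-- A fractional matching. -/
def IsFracMatching {n : ℕ} (μ : Fin n → Fin n → ℝ) : Prop :=
  (∀ m w, 0 ≤ μ m w) ∧ (∀ m, ∑ w, μ m w ≤ 1) ∧ (∀ w, ∑ m, μ m w ≤ 1)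

/-- Utility of man `m` under fractional matching `μ`. -/
def manUtil {n : ℕ} (U μ : Fin n → Fin n → ℝ) (m : Fin n) : ℝ :=
  ∑ w, μ m w * U m w

/-- Utility of woman `w` under fractional matching `μ`. -/
def womanUtil {n : ℕ} (V μ : Fin n → Fin n → ℝ) (w : Fin n) : ℝ :=
  ∑ m, μ m w * V m w

/-- `(m, w)` blocks `μ`. -/
def Blocks {n : ℕ} (U V μ : Fin n → Fin n → ℝ) (m w : Fin n) : Prop :=
  U m w > manUtil U μ m ∧ V m w > womanUtil V μ w

/-- Stability of a fractional matching. -/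
def IsStable {n : ℕ} (U V μ : Fin n → Fin n → ℝ) : Prop :=
  ¬ ∃ m w, Blocks U V μ m w

/-- Integral matchings: all weights are 0 or 1. -/
def Integral {n : ℕ} (μ : Fin n → Fin n → ℝ) : Prop :=
  ∀ m w, μ m w = 0 ∨ μ m w = 1

/-- `(m, w)` is a mutual-first-preference pair. -/
def MFP {n : ℕ} (U V : Fin n → Fin n → ℝ) (m w : Fin n) : Prop :=
  (∀ w', w' ≠ w → U m w > U m w') ∧ (∀ m', m' ≠ m → V m w > V m' w)

/-- The conditioned mutual first preference (CMFP) property. -/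
def CMFP {n : ℕ} (U V : Fin n → Fin n → ℝ) : Prop :=
  ∃ mseq wseq : Equiv.Perm (Fin n),
    ∀ t s : Fin n, t < s →
      U (mseq t) (wseq t) > U (mseq t) (wseq s) ∧
      V (mseq t) (wseq t) > V (mseq s) (wseq t)

/-- The perfect integral matching that matches man `m` to woman `σ m`. -/
def permMatching {n : ℕ} (σ : Equiv.Perm (Fin n)) (m w : Fin n) : ℝ :=
  if w = σ m then 1 else 0

lemma manUtil_permMatching {n : ℕ} (U : Fin n → Fin n → ℝ) (σ : Equiv.Perm (Fin n))
    (m : Fin n) : manUtil U (permMatching σ) m = U m (σ m) := by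
  simp [manUtil, permMatching]

lemma womanUtil_permMatching {n : ℕ} (V : Fin n → Fin n → ℝ) (σ : Equiv.Perm (Fin n))
    (w : Fin n) : womanUtil V (permMatching σ) w = V (σ.symm w) w := by
  simp [womanUtil, permMatching, ← Equiv.symm_apply_eq]

lemma isFracMatching_permMatching {n : ℕ} (σ : Equiv.Perm (Fin n)) :
    IsFracMatching (permMatching σ) := by
  refine ⟨fun m w => ?_, fun m => ?_, fun w => ?_⟩
  · unfold permMatching
    split_ifs <;> norm_num
  · simp [permMatching]
  · simp [permMatching, ← Equiv.symm_apply_eq]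

lemma manUtil_combination {n : ℕ} (U μ ν : Fin n → Fin n → ℝ) (a b : ℝ) (m : Fin n) :
    manUtil U (fun m w => a * μ m w + b * ν m w) m = a * manUtil U μ m + b * manUtil U ν m := by
  simp only [manUtil, mul_sum, ← sum_add_distrib]
  exact sum_congr rfl fun w _ => by ring

lemma womanUtil_combination {n : ℕ} (V μ ν : Fin n → Fin n → ℝ) (a b : ℝ) (w : Fin n) :
    womanUtil V (fun m w => a * μ m w + b * ν m w) w =
      a * womanUtil V μ w + b * womanUtil V ν w := by
  simp only [womanUtil, mul_sum, ← sum_add_distrib]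
  exact sum_congr rfl fun m _ => by ring

lemma IsFracMatching.convex_combination {n : ℕ} {μ ν : Fin n → Fin n → ℝ}
    (hμ : IsFracMatching μ) (hν : IsFracMatching ν) {a : ℝ} (ha : 0 ≤ a) (ha' : a ≤ 1) :
    IsFracMatching fun m w => a * μ m w + (1 - a) * ν m w := by
  have hb : 0 ≤ 1 - a := sub_nonneg.2 ha'
  refine ⟨fun m w => add_nonneg (mul_nonneg ha (hμ.1 m w)) (mul_nonneg hb (hν.1 m w)),
    fun m => ?_, fun w => ?_⟩
  · rw [sum_add_distrib, ← mul_sum, ← mul_sum]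
    linarith [mul_le_mul_of_nonneg_left (hμ.2.1 m) ha, mul_le_mul_of_nonneg_left (hν.2.1 m) hb]
  · rw [sum_add_distrib, ← mul_sum, ← mul_sum]
    linarith [mul_le_mul_of_nonneg_left (hμ.2.2 w) ha, mul_le_mul_of_nonneg_left (hν.2.2 w) hb]

/-- A permutation sending each term of an injective cyclic sequence to the next one and fixing
every other point. -/
lemma exists_perm_rotating {α : Type*} [DecidableEq α] {k : ℕ} (f : Fin (k + 1) → α)
    (hf : Function.Injective f) :
    ∃ π : Equiv.Perm α, (∀ i, π (f i) = f (i + 1)) ∧ ∀ a, (∀ i, a ≠ f i) → π a = a := by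
  refine ⟨(finRotate (k + 1)).viaFintypeEmbedding ⟨f, hf⟩, fun i => ?_, fun a ha => ?_⟩
  · simpa using (finRotate (k + 1)).viaFintypeEmbedding_apply_image ⟨f, hf⟩ i
  · refine Equiv.Perm.viaFintypeEmbedding_apply_notMem_range _ _ ?_
    rintro ⟨i, hi⟩
    exact ha i hi.symm

/-- If every woman weakly prefers her partner under `τ` to her partner under the stable
matching `σ`, then moving a little weight from `σ` to `τ` preserves stability. -/
lemma exists_stable_convex_combination {n : ℕ} (U V : Fin n → Fin n → ℝ)
    (hU : ∀ m, Function.Injective fun w => U m w) (σ τ : Equiv.Perm (Fin n))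
    (hσ : IsStable U V (permMatching σ))
    (hτ : ∀ w, V (σ.symm w) w ≤ V (τ.symm w) w) :
    ∃ x : ℝ, 0 ≤ x ∧ x < 1 ∧ ∀ α : ℝ, x ≤ α → α ≤ 1 →
      IsFracMatching (fun m w => α * permMatching σ m w + (1 - α) * permMatching τ m w) ∧
      IsStable U V (fun m w => α * permMatching σ m w + (1 - α) * permMatching τ m w) := by
  have hev : ∀ᶠ α in nhds (1 : ℝ), ∀ m w, U m w < U m (σ m) →
      U m w < α * U m (σ m) + (1 - α) * U m (τ m) := by
    simp only [Filter.eventually_all]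
    intro m w h
    have hc : Continuous fun α : ℝ => α * U m (σ m) + (1 - α) * U m (τ m) := by fun_prop
    exact hc.continuousAt.eventually_const_lt (by simpa using h)
  obtain ⟨ε, hε, hball⟩ := Metric.eventually_nhds_iff.1 hev
  refine ⟨max 0 (1 - ε / 2), le_max_left _ _, max_lt one_pos (by linarith),
    fun α hα hα1 => ?_⟩
  obtain ⟨hα0, hαε⟩ := max_le_iff.1 hα
  refine ⟨(isFracMatching_permMatching σ).convex_combination (isFracMatching_permMatching τ)
    hα0 hα1, ?_⟩
  rintro ⟨m, w, hm, hw⟩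
  simp only [manUtil_combination, womanUtil_combination, manUtil_permMatching,
    womanUtil_permMatching, gt_iff_lt] at hm hw
  have hVw : V (σ.symm w) w < V m w := by
    linarith [mul_le_mul_of_nonneg_left (hτ w) (sub_nonneg.2 hα1)]
  have hUle : U m w ≤ U m (σ m) := by
    by_contra! h
    exact hσ ⟨m, w, by rwa [manUtil_permMatching], by rwa [womanUtil_permMatching]⟩
  have hne : U m w ≠ U m (σ m) := by
    intro h
    obtain rfl : w = σ m := hU m h
    simp at hVw
  have hdist : dist α 1 < ε := by
    rw [Real.dist_eq, abs_lt]
    constructor <;> linarith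
  exact (hball hdist m w (hUle.lt_of_ne hne)).not_gt hm

/-- If the women's envy-graph under a stable perfect integral
matching `μ1` (man `m` matched to woman `σ m`) contains a cycle
`wseq 0, wseq 1, …` (of length `k + 2 ≥ 2`), and `μ2` is obtained from `μ1` by
matching each woman in the cycle to the `μ1`-partner of her successor, then
for some `x ∈ [0,1)` the matching `α·μ1 + (1−α)·μ2` is stable for all
`α ∈ [x,1]`. -/
theorem envy_cycle_gives_stable_fractional {n k : ℕ} (U V : Fin n → Fin n → ℝ)
    (hnn : Nonneg U V) (hsp : StrictPrefs U V)
    (σ : Equiv.Perm (Fin n))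
    (μ1 : Fin n → Fin n → ℝ)
    (hμ1 : ∀ m w, μ1 m w = if w = σ m then (1 : ℝ) else 0)
    (hμ1st : IsStable U V μ1)
    (wseq : Fin (k + 2) → Fin n) (hwinj : Function.Injective wseq)
    (hcycle : ∀ i : Fin (k + 2),
      V (σ.symm (wseq (i + 1))) (wseq i) > V (σ.symm (wseq i)) (wseq i))
    (μ2 : Fin n → Fin n → ℝ)
    (hμ2 : ∀ m w, μ2 m w =
      if (∃ i : Fin (k + 2), w = wseq i ∧ m = σ.symm (wseq (i + 1))) ∨
         ((∀ i : Fin (k + 2), w ≠ wseq i) ∧ m = σ.symm w)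
      then (1 : ℝ) else 0) :
    ∃ x : ℝ, 0 ≤ x ∧ x < 1 ∧ ∀ α : ℝ, x ≤ α → α ≤ 1 →
      IsFracMatching (fun m w => α * μ1 m w + (1 - α) * μ2 m w) ∧
      IsStable U V (fun m w => α * μ1 m w + (1 - α) * μ2 m w) := by
  obtain ⟨π, hπ_seq, hπ_off⟩ := exists_perm_rotating wseq hwinj
  have hμ1' : μ1 = permMatching σ := by
    ext m w
    simp [hμ1, permMatching]
  have hμ2' : μ2 = permMatching (σ.trans π.symm) := by
    ext m w
    have hmw : w = (σ.trans π.symm) m ↔ m = σ.symm (π w) := by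
      rw [Equiv.trans_apply, Equiv.eq_symm_apply, Equiv.eq_symm_apply, eq_comm]
    rw [hμ2, permMatching]
    refine if_congr ?_ rfl rfl
    rw [hmw]
    constructor
    · rintro (⟨i, rfl, rfl⟩ | ⟨h, rfl⟩)
      · rw [hπ_seq]
      · rw [hπ_off w h]
    · intro h
      by_cases hw : ∃ i, w = wseq i
      · obtain ⟨i, rfl⟩ := hw
        exact Or.inl ⟨i, rfl, by rw [h, hπ_seq]⟩
      · push Not at hw
        exact Or.inr ⟨hw, by rw [h, hπ_off w hw]⟩
  subst hμ1' hμ2'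
  refine exists_stable_convex_combination U V hsp.1 σ _ hμ1st fun w => ?_
  simp only [Equiv.symm_trans_apply, Equiv.symm_symm]
  by_cases hw : ∃ i, w = wseq i
  · obtain ⟨i, rfl⟩ := hw
    rw [hπ_seq]
    exact (hcycle i).le
  · push Not at hw
    rw [hπ_off w hw]
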